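/- For all (e,ℓ) ∈ [0,1) × ℝ one has C(e,ℓ)² + S(e,ℓ)² = 1, and there exists a C^∞ function V : [0,1) × ℝ → ℝ with V(0,ℓ) = ℓ, cos(V(e,ℓ)) = C(e,ℓ) and sin(V(e,ℓ)) = S(e,ℓ) for all (e,ℓ) (a smooth global branch of the true anomaly). -/

import Mathlib

/-- `C(e,ℓ) = (cos(u(e,ℓ)) − e)/(1 − e·cos(u(e,ℓ)))`, the cosine of the true anomaly. -/
noncomputable def Cfun (U : ℝ → ℝ → ℝ) (e ℓ : ℝ) : ℝ :=
  (Real.cos (U e ℓ) - e) / (1 - e * Real.cos (U e ℓ))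

/-- `S(e,ℓ) = √(1−e²)·sin(u(e,ℓ))/(1 − e·cos(u(e,ℓ)))`, the sine of the true anomaly. -/
noncomputable def Sfun (U : ℝ → ℝ → ℝ) (e ℓ : ℝ) : ℝ :=
  Real.sqrt (1 - e ^ 2) * Real.sin (U e ℓ) / (1 - e * Real.cos (U e ℓ))

open Set Filter Topology

lemma kep_lt {e u : ℝ} (he : e ∈ Ioo (-1:ℝ) 1) : 0 < 1 - e * Real.cos u := by
  have h1 := Real.cos_le_one u
  have h2 := Real.neg_one_le_cos u
  obtain ⟨h3, h4⟩ := he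
  rcases le_total 0 (Real.cos u) with h | h <;> nlinarith

lemma kep_strictMono {e : ℝ} (he : e ∈ Ioo (-1:ℝ) 1) :
    StrictMono (fun u : ℝ => u - e * Real.sin u) := by
  apply strictMono_of_deriv_pos
  intro u
  have : HasDerivAt (fun u : ℝ => u - e * Real.sin u) (1 - e * Real.cos u) u :=
    (hasDerivAt_id u).sub ((Real.hasDerivAt_sin u).const_mul e)
  rw [this.deriv]
  exact kep_lt he

lemma kep_exists {e : ℝ} (he : e ∈ Ioo (-1:ℝ) 1) (l : ℝ) :
    ∃ u : ℝ, u - e * Real.sin u = l := by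
  have hc : Continuous (fun u : ℝ => u - e * Real.sin u) := by fun_prop
  have hb : ∀ u : ℝ, |e * Real.sin u| ≤ 1 := by
    intro u
    rw [abs_mul]
    have := Real.abs_sin_le_one u
    have h2 : |e| ≤ 1 := abs_le.2 ⟨he.1.le, he.2.le⟩
    nlinarith [abs_nonneg e, abs_nonneg (Real.sin u)]
  have h := intermediate_value_univ (l - 1) (l + 1) hc
  obtain ⟨u, hu⟩ := h (show l ∈ Icc _ _ from by
    have a := abs_le.1 (hb (l - 1))
    have b := abs_le.1 (hb (l + 1))
    constructor <;> linarith [a.1, a.2, b.1, b.2])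
  exact ⟨u, hu⟩

/-- The derivative of `(e,u) ↦ (e, u - e sin u)`. -/
noncomputable def kepEquiv (c d : ℝ) (hd : d ≠ 0) : (ℝ × ℝ) ≃L[ℝ] (ℝ × ℝ) :=
  ContinuousLinearEquiv.equivOfInverse
    ((ContinuousLinearMap.fst ℝ ℝ ℝ).prod
      (c • ContinuousLinearMap.fst ℝ ℝ ℝ + d • ContinuousLinearMap.snd ℝ ℝ ℝ))
    ((ContinuousLinearMap.fst ℝ ℝ ℝ).prod
      (d⁻¹ • (ContinuousLinearMap.snd ℝ ℝ ℝ - c • ContinuousLinearMap.fst ℝ ℝ ℝ)))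
    (by
      rintro ⟨a, b⟩
      simp [hd])
    (by
      rintro ⟨a, b⟩
      simp [hd])

lemma kep_smooth (W : ℝ → ℝ → ℝ)
    (hW : ∀ e ∈ Ioo (-1:ℝ) 1, ∀ l : ℝ, W e l - e * Real.sin (W e l) = l)
    (e l : ℝ) (he : e ∈ Ioo (-1:ℝ) 1) :
    ContDiffAt ℝ (⊤ : ℕ∞) (fun p : ℝ × ℝ => W p.1 p.2) (e, l) := by
  set F : ℝ × ℝ → ℝ × ℝ := fun p => (p.1, p.2 - p.1 * Real.sin p.2) with hF
  set a : ℝ × ℝ := (e, W e l) with ha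
  have hFc : ContDiff ℝ (⊤ : ℕ∞) F := by
    apply ContDiff.prodMk contDiff_fst
    exact contDiff_snd.sub (contDiff_fst.mul (Real.contDiff_sin.comp contDiff_snd))
  have hd := (kep_lt (u := W e l) he).ne'
  have hF' : HasFDerivAt F
      (kepEquiv (-Real.sin (W e l)) (1 - e * Real.cos (W e l)) hd : (ℝ × ℝ) →L[ℝ] (ℝ × ℝ)) a := by
    have h1 : HasFDerivAt (fun p : ℝ × ℝ => p.1) (ContinuousLinearMap.fst ℝ ℝ ℝ) a := hasFDerivAt_fst
    have h2 : HasFDerivAt (fun p : ℝ × ℝ => p.2) (ContinuousLinearMap.snd ℝ ℝ ℝ) a := hasFDerivAt_snd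
    have h3 := h1.prodMk (h2.sub (h1.mul h2.sin))
    refine h3.congr_fderiv ?_
    ext <;> simp [kepEquiv, ha] <;> ring
  have hFa : F a = (e, l) := by
    simp only [hF, ha, hW e he l]
  have hn : ((⊤ : ℕ∞) : WithTop ℕ∞) ≠ 0 := by simp
  have hs := hFc.contDiffAt.to_localInverse hF' hn
  have hst := hFc.contDiffAt.hasStrictFDerivAt' hF' hn
  have hev := hst.eventually_right_inverse
  have hc : ContinuousAt (hst.localInverse F _ a) (F a) := hst.localInverse_continuousAt
  have hga : hst.localInverse F _ a (F a) = a := hst.localInverse_apply_image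
  have hmem : ∀ᶠ p in 𝓝 (F a), (hst.localInverse F _ a p).1 ∈ Ioo (-1:ℝ) 1 := by
    have := (continuous_fst.continuousAt.comp hc)
    apply this.eventually_mem
    simp only [Function.comp, hga]
    exact isOpen_Ioo.mem_nhds he
  rw [← hFa]
  have hs2 : ContDiffAt ℝ (⊤ : ℕ∞) (fun p => (hst.localInverse F _ a p).2) (F a) := hs.snd
  refine hs2.congr_of_eventuallyEq ?_
  filter_upwards [hev, hmem] with p hp hm
  have e1 : (hst.localInverse F _ a p).1 = p.1 := by
    have h := congrArg (fun q : ℝ × ℝ => q.1) hp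
    exact h
  have e2 : (hst.localInverse F _ a p).2 - (hst.localInverse F _ a p).1 *
      Real.sin (hst.localInverse F _ a p).2 = p.2 := by
    have h := congrArg (fun q : ℝ × ℝ => q.2) hp
    exact h
  rw [e1] at e2 hm
  apply (kep_strictMono hm).injective
  simp only
  rw [hW _ hm, e2]

lemma kep_cs (t : ℝ) : Real.cos (2 * Real.arctan t) = (1 - t^2) / (1 + t^2) ∧
    Real.sin (2 * Real.arctan t) = 2 * t / (1 + t^2) := by
  have h : (0:ℝ) < 1 + t^2 := by positivity
  have hc := Real.cos_sq_arctan t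
  have ht : Real.sin (Real.arctan t) = t * Real.cos (Real.arctan t) := by
    have := Real.tan_arctan t
    rw [Real.tan_eq_sin_div_cos, div_eq_iff (Real.cos_arctan_pos t).ne'] at this
    exact this
  constructor
  · rw [Real.cos_two_mul, hc]; field_simp; ring
  · rw [Real.sin_two_mul, ht]
    have : 2 * (t * Real.cos (Real.arctan t)) * Real.cos (Real.arctan t)
      = 2 * t * Real.cos (Real.arctan t)^2 := by ring
    rw [this, hc]; field_simp

/-- The classical formula for the true anomaly. -/
noncomputable def kepV (e u : ℝ) : ℝ :=
  u + 2 * Real.arctan (e * Real.sin u / (1 + Real.sqrt (1 - e^2) - e * Real.cos u))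

lemma kep_den {e u : ℝ} (he : e ∈ Ioo (-1:ℝ) 1) :
    0 < 1 + Real.sqrt (1 - e^2) - e * Real.cos u := by
  have := kep_lt (u := u) he
  have := Real.sqrt_nonneg (1 - e^2)
  linarith

lemma kepV_spec {e u : ℝ} (he : e ∈ Ioo (-1:ℝ) 1) :
    Real.cos (kepV e u) = (Real.cos u - e) / (1 - e * Real.cos u) ∧
    Real.sin (kepV e u) = Real.sqrt (1 - e ^ 2) * Real.sin u / (1 - e * Real.cos u) := by
  have hd := kep_lt (u := u) he
  have hD := kep_den (u := u) he
  have hpos : 0 < 1 - e^2 := by nlinarith [he.1, he.2]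
  have hr := Real.sq_sqrt hpos.le
  have hr0 := Real.sqrt_nonneg (1 - e^2)
  unfold kepV
  rw [Real.cos_add, Real.sin_add, (kep_cs _).1, (kep_cs _).2]
  have hsc := Real.sin_sq_add_cos_sq u
  set r := Real.sqrt (1 - e^2)
  set s := Real.sin u
  set c := Real.cos u
  set D := 1 + r - e * c with hDdef
  have key : D^2 + (e*s)^2 = 2 * (1 + r) * (1 - e * c) := by
    rw [hDdef]; linear_combination hr + e^2 * hsc
  have h1 : (1 - (e * s / D)^2) / (1 + (e * s / D)^2) =
      (D^2 - (e*s)^2) / (2 * (1 + r) * (1 - e * c)) := by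
    rw [← key]; field_simp
  have h2 : 2 * (e * s / D) / (1 + (e * s / D)^2) =
      (2 * (e*s) * D) / (2 * (1 + r) * (1 - e * c)) := by
    rw [← key]; field_simp
  rw [h1, h2]
  have hr1 : 1 + r ≠ 0 := by positivity
  have hs2 : s^2 = 1 - c^2 := by linarith
  have he2 : e^2 = 1 - r^2 := by linarith
  constructor
  · have k : c * (D^2 - (e*s)^2) - s * (2 * (e*s) * D) = 2 * (1 + r) * (c - e) := by
      rw [hDdef]
      linear_combination (-c * e^2 - 2 * e * (1 + r - e * c)) * hsc + c * hr
    rw [← mul_div_assoc, ← mul_div_assoc, ← sub_div, k]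
    field_simp
  · have k : s * (D^2 - (e*s)^2) + c * (2 * (e*s) * D) = 2 * (1 + r) * (r * s) := by
      rw [hDdef]
      linear_combination (-s * e^2) * hsc - s * hr
    rw [← mul_div_assoc, ← mul_div_assoc, ← add_div, k]
    field_simp

theorem stmt_4 (U : ℝ → ℝ → ℝ)
    (hU : ∀ e ∈ Set.Ico (0:ℝ) 1, ∀ ℓ : ℝ, U e ℓ - e * Real.sin (U e ℓ) = ℓ) :
    (∀ e ∈ Set.Ico (0:ℝ) 1, ∀ ℓ : ℝ, Cfun U e ℓ ^ 2 + Sfun U e ℓ ^ 2 = 1) ∧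
    ∃ V : ℝ → ℝ → ℝ,
      ContDiffOn ℝ (⊤ : ℕ∞) (fun p : ℝ × ℝ => V p.1 p.2)
        (Set.Ico (0:ℝ) 1 ×ˢ (Set.univ : Set ℝ)) ∧
      (∀ ℓ : ℝ, V 0 ℓ = ℓ) ∧
      (∀ e ∈ Set.Ico (0:ℝ) 1, ∀ ℓ : ℝ,
        Real.cos (V e ℓ) = Cfun U e ℓ ∧ Real.sin (V e ℓ) = Sfun U e ℓ) := by
  have hsub : ∀ e ∈ Ico (0:ℝ) 1, e ∈ Ioo (-1:ℝ) 1 := fun e he => ⟨by linarith [he.1], he.2⟩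
  have hspec : ∀ e ∈ Set.Ico (0:ℝ) 1, ∀ ℓ : ℝ,
        Real.cos (kepV e (U e ℓ)) = Cfun U e ℓ ∧ Real.sin (kepV e (U e ℓ)) = Sfun U e ℓ :=
    fun e he ℓ => kepV_spec (hsub e he)
  refine ⟨fun e he ℓ => ?_, fun e ℓ => kepV e (U e ℓ), ?_, fun ℓ => ?_, hspec⟩
  · rw [← (hspec e he ℓ).1, ← (hspec e he ℓ).2]
    exact Real.cos_sq_add_sin_sq _
  · have hex : ∀ e l : ℝ, ∃ u : ℝ, e ∈ Ioo (-1:ℝ) 1 → u - e * Real.sin u = l := by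
      intro e l
      by_cases he : e ∈ Ioo (-1:ℝ) 1
      · obtain ⟨u, hu⟩ := kep_exists he l
        exact ⟨u, fun _ => hu⟩
      · exact ⟨0, fun h => absurd h he⟩
    choose W hW using hex
    have hW' : ∀ e ∈ Ioo (-1:ℝ) 1, ∀ l : ℝ, W e l - e * Real.sin (W e l) = l :=
      fun e he l => hW e l he
    have hWU : ∀ e ∈ Ico (0:ℝ) 1, ∀ l, U e l = W e l := by
      intro e he l
      apply (kep_strictMono (hsub e he)).injective
      simp only
      rw [hU e he l, hW' e (hsub e he) l]
    have hsm : ContDiffOn ℝ (⊤ : ℕ∞) (fun p : ℝ × ℝ => kepV p.1 (W p.1 p.2))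
        (Set.Ico (0:ℝ) 1 ×ˢ (Set.univ : Set ℝ)) := by
      rintro ⟨e, l⟩ ⟨he, -⟩
      apply ContDiffAt.contDiffWithinAt
      have he' := hsub e he
      have hw := kep_smooth W hW' e l he'
      have h1 : ContDiffAt ℝ (⊤ : ℕ∞) (fun p : ℝ × ℝ => p.1) (e, l) := contDiffAt_fst
      have hpos : (1 - e^2) ≠ 0 := by nlinarith [he.1, he.2]
      have hq : ContDiffAt ℝ (⊤ : ℕ∞) (fun p : ℝ × ℝ => Real.sqrt (1 - p.1^2)) (e, l) :=
        (contDiffAt_const.sub (h1.pow 2)).sqrt hpos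
      unfold kepV
      exact hw.add (contDiffAt_const.mul (((h1.mul hw.sin).div
        ((contDiffAt_const.add hq).sub (h1.mul hw.cos)) (kep_den he').ne').arctan))
    refine hsm.congr ?_
    rintro ⟨e, l⟩ ⟨he, -⟩
    simp only
    rw [hWU e he l]
  · have := hU 0 (by simp) ℓ
    simp only [zero_mul, sub_zero] at this
    simp [kepV, this]
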